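/- arXiv:2605.04258 — 2 statements merged into one kernel-verified Lean document; each statement's English description precedes it below -/
import Mathlib

section
/- For every index x with 1 < x ≤ n such that BWT[x] ≠ BWT[x-1], and every character c ∈ {BWT[x], BWT[x-1]}, the index p := Candt_c(b(x), e(x)) satisfies p ≠ -1 and w(p) ≥ LCP[x]. -/
open scoped Classical

/-- `seg T i len` is the string `T[i..i+len-1]`. -/
def seg (T : ℕ → ℤ) (i len : ℕ) : List ℤ :=
  (List.range len).map fun k => T (i + k)

/-- `sfx T n p` is the suffix `T[p..n]` of a length-`n` text. -/
def sfx (T : ℕ → ℤ) (n p : ℕ) : List ℤ := seg T p (n + 1 - p)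

/-- The reversed text: `Trev T n n = T n` and `Trev T n i = T (n - i)` for `i < n`. -/
def Trev (T : ℕ → ℤ) (n : ℕ) : ℕ → ℤ := fun i => if i = n then T n else T (n - i)

/-- Length of the longest common prefix of two strings. -/
def lcpLen : List ℤ → List ℤ → ℕ
  | a :: l₁, b :: l₂ => if a = b then lcpLen l₁ l₂ + 1 else 0
  | _, _ => 0

/-- `s` occurs as a substring of `T[1..n]`. -/
def OccursIn (T : ℕ → ℤ) (n : ℕ) (s : List ℤ) : Prop :=
  ∃ i : ℕ, 1 ≤ i ∧ i + s.length ≤ n + 1 ∧ s = seg T i s.length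

/-- `s` is a right-maximal substring of `T[1..n]` over the alphabet `{1,…,σ}`. -/
def RightMax (T : ℕ → ℤ) (n σ : ℕ) (s : List ℤ) : Prop :=
  ∃ a b : ℤ, a ≠ b ∧ 1 ≤ a ∧ a ≤ (σ : ℤ) ∧ 1 ≤ b ∧ b ≤ (σ : ℤ) ∧
    OccursIn T n (s ++ [a]) ∧ OccursIn T n (s ++ [b])

/-- `X` is a suffixient set for `T[1..n]`. -/
def Suffixient (T : ℕ → ℤ) (n σ : ℕ) (X : Set ℕ) : Prop :=
  ∀ s : List ℤ, RightMax T n σ s → ∀ c : ℤ, 1 ≤ c → c ≤ (σ : ℤ) →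
    OccursIn T n (s ++ [c]) → ∃ x ∈ X, (s ++ [c]) <:+ seg T 1 x

def StartRun (BWT : ℕ → ℤ) (x : ℕ) : Prop := 1 < x ∧ BWT x ≠ BWT (x - 1)

def EndRun (BWT : ℕ → ℤ) (n x : ℕ) : Prop := x < n ∧ BWT x ≠ BWT (x + 1)

def RunBoundary (BWT : ℕ → ℤ) (n x : ℕ) : Prop := StartRun BWT x ∨ EndRun BWT n x

/-- `bIdx L x` : the largest index `y < x` with `L y < L x`, or `1` if none exists. -/
noncomputable def bIdx (L : ℕ → ℤ) (x : ℕ) : ℕ :=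
  sSup {y : ℕ | (1 ≤ y ∧ y < x ∧ L y < L x) ∨ y = 1}

/-- `eIdx L n x` : the smallest index `y > x` with `L y < L x`, or `n+1` if none exists. -/
noncomputable def eIdx (L : ℕ → ℤ) (n x : ℕ) : ℕ :=
  sInf {y : ℕ | (x < y ∧ y ≤ n ∧ L y < L x) ∨ y = n + 1}

/-- The maximal weight `w y` over indices `a ≤ y < a'` with `BWT y = c` and `w y ≥ 0`. -/
noncomputable def wMax (BWT w : ℕ → ℤ) (c : ℤ) (a a' : ℕ) : ℤ :=
  (sSup {m : ℕ | ∃ q : ℕ, a ≤ q ∧ q < a' ∧ BWT q = c ∧ 0 ≤ w q ∧ (m : ℤ) = w q} : ℕ)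

/-- `Candt BWT w c a a'`: the smallest index `a ≤ p < a'` with `BWT p = c` whose weight
attains the maximum weight among such indices; `-1` if no index
`a ≤ y < a'` with `BWT y = c` and `w y ≥ 0` exists. -/
noncomputable def Candt (BWT w : ℕ → ℤ) (c : ℤ) (a a' : ℕ) : ℤ :=
  if ∃ p : ℕ, a ≤ p ∧ p < a' ∧ BWT p = c ∧ 0 ≤ w p then
    ((sInf {p : ℕ | a ≤ p ∧ p < a' ∧ BWT p = c ∧ w p = wMax BWT w c a a'} : ℕ) : ℤ)
  else -1

def FullL (n : ℕ) (SA : ℕ → ℕ) (BWT LCP w : ℕ → ℤ) : Set ℕ :=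
  { q | ∃ x : ℕ, 1 < x ∧ x ≤ n ∧ BWT x ≠ BWT (x - 1) ∧
      ∃ c : ℤ, (c = BWT x ∨ c = BWT (x - 1)) ∧
      ∃ p : ℕ, (p : ℤ) = Candt BWT w c (bIdx LCP x) (eIdx LCP n x) ∧
        q = n - SA p + 1 }

/-- Basic assumptions on the text `T[1..n]` over alphabet `{1,…,σ}` with sentinel `dollar`. -/
structure TextSetup (n σ : ℕ) (T : ℕ → ℤ) (dollar : ℤ) : Prop where
  hn : 2 ≤ n
  hsigma : 2 ≤ σ
  hsigma_le : σ ≤ n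
  hT : ∀ i, 1 ≤ i → i ≤ n → 1 ≤ T i ∧ T i ≤ (σ : ℤ)
  hTn : T n = dollar
  hTne : ∀ i, 1 ≤ i → i < n → T i ≠ dollar

/-- `SA[1..n]` is the suffix array of the reversed text. -/
structure SASetup (n σ : ℕ) (T : ℕ → ℤ) (dollar : ℤ) (SA : ℕ → ℕ)
    extends TextSetup n σ T dollar : Prop where
  hSAmem : ∀ i, 1 ≤ i → i ≤ n → 1 ≤ SA i ∧ SA i ≤ n
  hSAinj : ∀ i j, 1 ≤ i → i ≤ n → 1 ≤ j → j ≤ n → SA i = SA j → i = j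
  hSAsurj : ∀ p, 1 ≤ p → p ≤ n → ∃ i, 1 ≤ i ∧ i ≤ n ∧ SA i = p
  hSAord : ∀ i j, 1 ≤ i → i < j → j ≤ n →
    List.Lex (· < ·) (sfx (Trev T n) n (SA i)) (sfx (Trev T n) n (SA j))

/-- `LCP[1..n]` is the LCP array of the reversed text. -/
structure LCPSetup (n σ : ℕ) (T : ℕ → ℤ) (dollar : ℤ) (SA : ℕ → ℕ) (LCP : ℕ → ℤ)
    extends SASetup n σ T dollar SA : Prop where
  hLCP1 : LCP 1 = -1
  hLCP : ∀ i, 1 < i → i ≤ n →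
    LCP i = (lcpLen (sfx (Trev T n) n (SA (i - 1))) (sfx (Trev T n) n (SA i)) : ℤ)
  hLCPend : LCP (n + 1) = -1

/-- Additionally, `BWT[1..n]` is the BWT of the reversed text and `w` is the weight function. -/
structure FullSetup (n σ : ℕ) (T : ℕ → ℤ) (dollar : ℤ) (SA : ℕ → ℕ)
    (BWT LCP w : ℕ → ℤ) extends LCPSetup n σ T dollar SA LCP : Prop where
  hBWT : ∀ i, 1 ≤ i → i ≤ n → BWT i = T (n - SA i + 1)
  hBWTend : BWT (n + 1) = -1
  hwNot : ∀ x, 1 ≤ x → x ≤ n → ¬ RunBoundary BWT n x → w x = -1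
  hwRB : ∀ x, 1 ≤ x → x ≤ n → RunBoundary BWT n x →
    (∃ s : List ℤ, RightMax T n σ s ∧ s <:+ seg T 1 (n - SA x)) →
    IsGreatest {m : ℤ | ∃ s : List ℤ, RightMax T n σ s ∧ s <:+ seg T 1 (n - SA x) ∧
      m = (s.length : ℤ)} (w x)

/-- `sIdx`: the minimum index `i ∈ [1..n]` such that `T[n-SA[ℓ]+1-w(ℓ)..n-SA[ℓ]]`
is a suffix of `T[1..n-SA[i]]`. -/
noncomputable def sIdx (T : ℕ → ℤ) (n : ℕ) (SA : ℕ → ℕ) (w : ℕ → ℤ) (l : ℕ) : ℕ :=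
  sInf {i : ℕ | 1 ≤ i ∧ i ≤ n ∧
    seg T (n - SA l + 1 - (w l).toNat) (w l).toNat <:+ seg T 1 (n - SA i)}

/-- `tIdx`: the maximum such index. -/
noncomputable def tIdx (T : ℕ → ℤ) (n : ℕ) (SA : ℕ → ℕ) (w : ℕ → ℤ) (l : ℕ) : ℕ :=
  sSup {i : ℕ | 1 ≤ i ∧ i ≤ n ∧
    seg T (n - SA l + 1 - (w l).toNat) (w l).toNat <:+ seg T 1 (n - SA i)}

/-- `pIdx c i`: the largest index `j < i` with `w j > -1` and `BWT j = c`, or `0`. -/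
noncomputable def pIdx (BWT w : ℕ → ℤ) (c : ℤ) (i : ℕ) : ℕ :=
  sSup {j : ℕ | (1 ≤ j ∧ j < i ∧ -1 < w j ∧ BWT j = c) ∨ j = 0}

/-- `pW c i`: the weight of `pIdx c i`, or `-1` if no index as in `pIdx` exists. -/
noncomputable def pW (BWT w : ℕ → ℤ) (c : ℤ) (i : ℕ) : ℤ :=
  if ∃ j : ℕ, 1 ≤ j ∧ j < i ∧ -1 < w j ∧ BWT j = c then w (pIdx BWT w c i) else -1

/-- `α` is colexicographically smaller than `β`. -/
def ColexLt (α β : List ℤ) : Prop :=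
  (α ≠ β ∧ α <:+ β) ∨
  ∃ k : ℕ, 1 ≤ k ∧ k ≤ α.length ∧ k ≤ β.length ∧
    (∀ i, 1 ≤ i → i < k → α.getD (α.length - i) 0 = β.getD (β.length - i) 0) ∧
    α.getD (α.length - k) 0 < β.getD (β.length - k) 0

theorem length_seg (T : ℕ → ℤ) (i len : ℕ) : (seg T i len).length = len := by
  simp [seg]

theorem seg_add (T : ℕ → ℤ) (i a b : ℕ) : seg T i (a + b) = seg T i a ++ seg T (i + a) b := by
  simp [seg, List.range_add, Function.comp_def, Nat.add_assoc]

theorem seg_succ (T : ℕ → ℤ) (i a : ℕ) : seg T i (a + 1) = seg T i a ++ [T (i + a)] := by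
  simp [seg, List.range_succ]

theorem seg_congr {T : ℕ → ℤ} {i j len : ℕ} (h : ∀ k < len, T (i + k) = T (j + k)) :
    seg T i len = seg T j len := by
  unfold seg
  exact List.map_congr_left fun k hk => h k (List.mem_range.1 hk)

theorem getElem?_of_lt_lcpLen (l₁ l₂ : List ℤ) (k : ℕ) (hk : k < lcpLen l₁ l₂) :
    k < l₁.length ∧ k < l₂.length ∧ l₁[k]? = l₂[k]? := by
  induction l₁ generalizing l₂ k with
  | nil => simp [lcpLen] at hk
  | cons a l₁ ih =>
    cases l₂ with
    | nil => simp [lcpLen] at hk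
    | cons b l₂ =>
      by_cases hab : a = b
      · cases k with
        | zero => simp [hab]
        | succ k =>
          have := ih l₂ k (by simpa [lcpLen, hab] using hk)
          simpa using this
      · simp [lcpLen, hab] at hk

theorem eq_of_lt_lcpLen_sfx {T : ℕ → ℤ} {n p q k : ℕ}
    (hk : k < lcpLen (sfx T n p) (sfx T n q)) :
    p + k ≤ n ∧ q + k ≤ n ∧ T (p + k) = T (q + k) := by
  obtain ⟨h₁, h₂, h⟩ := getElem?_of_lt_lcpLen _ _ k hk
  rw [sfx, length_seg] at h₁ h₂
  refine ⟨by omega, by omega, ?_⟩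
  simpa [sfx, seg, h₁, h₂] using h

/-- The common prefix of two distinct suffixes of the reversed text avoids the sentinel. -/
theorem TextSetup.eq_of_lt_lcpLen {n σ : ℕ} {T : ℕ → ℤ} {dollar : ℤ}
    (h : TextSetup n σ T dollar) {p q k : ℕ} (hp : 1 ≤ p) (hq : 1 ≤ q) (hpq : p ≠ q)
    (hk : k < lcpLen (sfx (Trev T n) n p) (sfx (Trev T n) n q)) :
    p + k < n ∧ q + k < n ∧ T (n - (p + k)) = T (n - (q + k)) := by
  obtain ⟨h₁, h₂, he⟩ := eq_of_lt_lcpLen_sfx hk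
  have hTn := h.hTn
  unfold Trev at he
  split_ifs at he with hpn hqn hqn
  · omega
  · exact absurd (he.symm.trans hTn) (h.hTne _ (by omega) (by omega))
  · exact absurd (he.trans hTn) (h.hTne _ (by omega) (by omega))
  · exact ⟨by omega, by omega, he⟩

theorem occursIn_seg_append {T : ℕ → ℤ} {n p l : ℕ} (hp : 1 ≤ p) (hl : p + l ≤ n) :
    OccursIn T n (seg T (n + 1 - p - l) l ++ [T (n - p + 1)]) := by
  have hlen : (seg T (n + 1 - p - l) l ++ [T (n - p + 1)]).length = l + 1 := by
    simp [length_seg]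
  refine ⟨n + 1 - p - l, by omega, by omega, ?_⟩
  rw [hlen, seg_succ, show n + 1 - p - l + l = n - p + 1 by omega]

theorem seg_suffix_prefix {T : ℕ → ℤ} {n p l : ℕ} (hl : p + l ≤ n) :
    seg T (n + 1 - p - l) l <:+ seg T 1 (n - p) := by
  refine ⟨seg T 1 (n - p - l), ?_⟩
  rw [show n + 1 - p - l = 1 + (n - p - l) by omega, ← seg_add]
  congr 1
  omega

/-- At a run boundary `x - 1, x`, the reverse of the longest common prefix of the two suffixes
is right-maximal and is a suffix of both text prefixes. -/
theorem FullSetup.exists_rightMax {n σ : ℕ} {T : ℕ → ℤ} {dollar : ℤ} {SA : ℕ → ℕ}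
    {BWT LCP w : ℕ → ℤ} (h : FullSetup n σ T dollar SA BWT LCP w) {x : ℕ} (hx1 : 1 < x)
    (hxn : x ≤ n) (hrun : BWT x ≠ BWT (x - 1)) :
    ∃ s : List ℤ, RightMax T n σ s ∧ s <:+ seg T 1 (n - SA x) ∧
      s <:+ seg T 1 (n - SA (x - 1)) ∧ LCP x = s.length := by
  obtain ⟨hp1, hpn⟩ := h.hSAmem (x - 1) (by omega) (by omega)
  obtain ⟨hq1, hqn⟩ := h.hSAmem x (by omega) hxn
  have hpq : SA (x - 1) ≠ SA x := fun e => by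
    have := h.hSAinj _ _ (by omega) (by omega) (by omega) hxn e
    omega
  have hL := h.hLCP x hx1 hxn
  have hB := h.hBWT x (by omega) hxn
  have hB' := h.hBWT (x - 1) (by omega) (by omega)
  have hagree := fun k => h.toTextSetup.eq_of_lt_lcpLen (k := k) hp1 hq1 hpq
  generalize SA (x - 1) = p at *
  generalize SA x = q at *
  generalize lcpLen (sfx (Trev T n) n p) (sfx (Trev T n) n q) = l at *
  have hl : p + l ≤ n ∧ q + l ≤ n := by
    rcases Nat.eq_zero_or_pos l with rfl | hl
    · exact ⟨hpn, hqn⟩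
    · have := hagree (l - 1) (by omega)
      omega
  have hs : seg T (n + 1 - p - l) l = seg T (n + 1 - q - l) l := by
    refine seg_congr fun k hk => ?_
    have := (hagree (l - 1 - k) (by omega)).2.2
    convert this using 2 <;> omega
  have hTq := h.hT (n - q + 1) (by omega) (by omega)
  have hTp := h.hT (n - p + 1) (by omega) (by omega)
  refine ⟨seg T (n + 1 - q - l) l, ⟨T (n - q + 1), T (n - p + 1), ?_, hTq.1, hTq.2, hTp.1,
    hTp.2, occursIn_seg_append hq1 hl.2, hs ▸ occursIn_seg_append hp1 hl.1⟩,
    seg_suffix_prefix hl.2, hs ▸ seg_suffix_prefix hl.1, by rw [hL, length_seg]⟩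
  rwa [← hB, ← hB']

theorem FullSetup.length_le_weight {n σ : ℕ} {T : ℕ → ℤ} {dollar : ℤ} {SA : ℕ → ℕ}
    {BWT LCP w : ℕ → ℤ} (h : FullSetup n σ T dollar SA BWT LCP w) {x : ℕ} (hx1 : 1 ≤ x)
    (hxn : x ≤ n) (hb : RunBoundary BWT n x) {s : List ℤ} (hs : RightMax T n σ s)
    (hsx : s <:+ seg T 1 (n - SA x)) : (s.length : ℤ) ≤ w x :=
  (h.hwRB x hx1 hxn hb ⟨s, hs, hsx⟩).2 ⟨s, hs, hsx, rfl⟩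

theorem bIdx_lt {L : ℕ → ℤ} {x : ℕ} (hx : 1 < x) : bIdx L x < x := by
  have : bIdx L x ≤ x - 1 := by
    refine csSup_le ⟨1, Or.inr rfl⟩ ?_
    rintro y (hy | rfl) <;> omega
  omega

theorem lt_eIdx {L : ℕ → ℤ} {n x : ℕ} (hx : x ≤ n) : x < eIdx L n x := by
  have : x + 1 ≤ eIdx L n x := by
    refine le_csInf ⟨n + 1, Or.inr rfl⟩ ?_
    rintro y (hy | rfl) <;> omega
  omega

theorem Candt_spec {BWT w : ℕ → ℤ} {c : ℤ} {a a' y : ℕ} (hy : a ≤ y) (hy' : y < a')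
    (hc : BWT y = c) (hw : 0 ≤ w y) :
    ∃ p : ℕ, (p : ℤ) = Candt BWT w c a a' ∧ w y ≤ w p := by
  set S := {m : ℕ | ∃ q : ℕ, a ≤ q ∧ q < a' ∧ BWT q = c ∧ 0 ≤ w q ∧ (m : ℤ) = w q}
  have hbdd : BddAbove S := by
    refine ((Set.finite_Iio a').image fun q => (w q).toNat).bddAbove.mono ?_
    rintro m ⟨q, -, hq, -, -, hm⟩
    exact ⟨q, hq, by simp [← hm]⟩
  have hmem : (w y).toNat ∈ S := ⟨y, hy, hy', hc, hw, Int.toNat_of_nonneg hw⟩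
  obtain ⟨q, hq, hq', hqc, -, hqw⟩ := Nat.sSup_mem ⟨_, hmem⟩ hbdd
  have hp := Nat.sInf_mem
    (s := {p : ℕ | a ≤ p ∧ p < a' ∧ BWT p = c ∧ w p = wMax BWT w c a a'})
    ⟨q, hq, hq', hqc, hqw.symm⟩
  have hle : w y ≤ wMax BWT w c a a' := by
    have : (w y).toNat ≤ sSup S := le_csSup hbdd hmem
    change w y ≤ ((sSup S : ℕ) : ℤ)
    omega
  exact ⟨_, by rw [Candt, if_pos ⟨y, hy, hy', hc, hw⟩], hle.trans_eq hp.2.2.2.symm⟩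

/-- For every index `x` with `1 < x ≤ n` such that `BWT[x] ≠ BWT[x-1]`, and every
character `c ∈ {BWT[x], BWT[x-1]}`, the index `p := Candt_c(b(x), e(x))` satisfies `p ≠ -1`
and `w(p) ≥ LCP[x]`. -/
theorem stmt1 (n σ : ℕ) (T : ℕ → ℤ) (dollar : ℤ) (SA : ℕ → ℕ) (BWT LCP w : ℕ → ℤ)
    (hsetup : FullSetup n σ T dollar SA BWT LCP w)
    (x : ℕ) (hx1 : 1 < x) (hxn : x ≤ n) (hrun : BWT x ≠ BWT (x - 1))
    (c : ℤ) (hc : c = BWT x ∨ c = BWT (x - 1)) :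
    Candt BWT w c (bIdx LCP x) (eIdx LCP n x) ≠ -1 ∧
      ∃ p : ℕ, (p : ℤ) = Candt BWT w c (bIdx LCP x) (eIdx LCP n x) ∧ LCP x ≤ w p := by
  obtain ⟨s, hs, hsx, hsx', hL⟩ := hsetup.exists_rightMax hx1 hxn hrun
  have hb : bIdx LCP x < x := bIdx_lt hx1
  have he : x < eIdx LCP n x := lt_eIdx hxn
  obtain ⟨y, hy, hy', hyc, hyw⟩ : ∃ y, bIdx LCP x ≤ y ∧ y < eIdx LCP n x ∧ BWT y = c ∧
      LCP x ≤ w y := by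
    rw [hL]
    rcases hc with rfl | rfl
    · exact ⟨x, hb.le, he, rfl,
        hsetup.length_le_weight hx1.le hxn (Or.inl ⟨hx1, hrun⟩) hs hsx⟩
    · refine ⟨x - 1, by omega, by omega, rfl,
        hsetup.length_le_weight (by omega) (by omega) (Or.inr ⟨by omega, ?_⟩) hs hsx'⟩
      rw [Nat.sub_add_cancel hx1.le]
      exact hrun.symm
  obtain ⟨p, hp, hpw⟩ := Candt_spec hy hy' hyc (w := w) (by omega)
  exact ⟨by omega, p, hp, hyw.trans hpw⟩
end

section
/- For every set F ⊆ {1,…,n} that is suffixient for T, the cardinality of F is at least the cardinality of FullL. -/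
open scoped Classical

theorem seg_one_succ (T : ℕ → ℤ) (k : ℕ) : seg T 1 (k + 1) = seg T 1 k ++ [T (k + 1)] := by
  simp [seg, List.range_succ, Nat.add_comm]

theorem mem_seg_one {T : ℕ → ℤ} {k : ℕ} {a : ℤ} (h : a ∈ seg T 1 k) :
    ∃ i, 1 ≤ i ∧ i ≤ k ∧ T i = a := by
  simp only [seg, List.mem_map, List.mem_range] at h
  obtain ⟨j, hj, rfl⟩ := h
  exact ⟨1 + j, by omega, by omega, rfl⟩

/-- A suffix of the text `T` reversed is the reversal of a prefix of `T`, followed by the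
last character. -/
theorem sfx_Trev (T : ℕ → ℤ) {n p : ℕ} (hpn : p ≤ n) :
    sfx (Trev T n) n p = (seg T 1 (n - p)).reverse ++ [T n] := by
  apply List.ext_getElem
  · simp [sfx, length_seg]; omega
  · intro i h₁ h₂
    simp only [sfx, length_seg] at h₁
    rw [List.getElem_append]
    simp only [sfx, seg, Trev, List.getElem_map, List.getElem_range, List.length_reverse,
      List.length_map, List.length_range, List.getElem_reverse, List.getElem_singleton]
    split_ifs with h h' h'
    · omega
    · rfl
    · congr 1; omega
    · omega

theorem isPrefix_iff_of_length_le_lcpLen {A X Y : List ℤ} (h : A.length ≤ lcpLen X Y) :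
    A <+: X ↔ A <+: Y := by
  induction A generalizing X Y with
  | nil => simp
  | cons a A ih =>
    cases X with
    | nil => simp [lcpLen] at h
    | cons x X =>
      cases Y with
      | nil => simp [lcpLen] at h
      | cons y Y =>
        by_cases hxy : x = y
        · simp only [lcpLen, if_pos hxy, List.length_cons, Nat.add_le_add_iff_right] at h
          rw [List.cons_prefix_cons, List.cons_prefix_cons, ih h, hxy]
        · simp [lcpLen, hxy] at h

theorem length_le_lcpLen {A X Y : List ℤ} (hX : A <+: X) (hY : A <+: Y) :
    A.length ≤ lcpLen X Y := by
  induction A generalizing X Y with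
  | nil => simp
  | cons a A ih =>
    obtain ⟨X, rfl⟩ := hX
    obtain ⟨Y, rfl⟩ := hY
    simpa [lcpLen] using ih (List.prefix_append A X) (List.prefix_append A Y)

theorem exists_isPrefix_length_eq_lcpLen (X Y : List ℤ) :
    ∃ A : List ℤ, A.length = lcpLen X Y ∧ A <+: X ∧ A <+: Y := by
  induction X generalizing Y with
  | nil => exact ⟨[], by simp [lcpLen]⟩
  | cons x X ih =>
    cases Y with
    | nil => exact ⟨[], by simp [lcpLen]⟩
    | cons y Y =>
      by_cases hxy : x = y
      · obtain ⟨A, h, hX, hY⟩ := ih Y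
        exact ⟨x :: A, by simp [lcpLen, hxy, h], by simp [hX], by simp [hxy, hY]⟩
      · exact ⟨[], by simp [lcpLen, hxy]⟩

/-- The strings with a given prefix form a lexicographically convex set. -/
theorem isPrefix_of_lex_lex {A X Y Z : List ℤ} (hX : A <+: X) (hZ : A <+: Z)
    (hXY : List.Lex (· < ·) X Y) (hYZ : List.Lex (· < ·) Y Z) : A <+: Y := by
  induction A generalizing X Y Z with
  | nil => simp
  | cons a A ih =>
    obtain ⟨X, rfl⟩ := hX
    obtain ⟨Z, rfl⟩ := hZ
    cases Y with
    | nil => cases hXY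
    | cons y Y =>
      rw [List.cons_append, List.cons_lex_cons_iff] at hXY hYZ
      rcases hXY with h₁ | ⟨rfl, h₁⟩
      · rcases hYZ with h₂ | ⟨rfl, -⟩
        · exact absurd h₂ h₁.asymm
        · exact absurd h₁ (lt_irrefl _)
      · rcases hYZ with h₂ | ⟨-, h₂⟩
        · exact absurd h₂ (lt_irrefl _)
        · exact List.cons_prefix_cons.mpr
            ⟨rfl, ih (List.prefix_append A X) (List.prefix_append A Z) h₁ h₂⟩

theorem isSuffix_and_eq_of_concat_isSuffix {s t : List ℤ} {a b : ℤ}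
    (h : s ++ [a] <:+ t ++ [b]) : s <:+ t ∧ a = b := by
  obtain ⟨r, h⟩ := h
  rw [← List.append_assoc] at h
  obtain ⟨h₁, h₂⟩ := List.append_inj' h rfl
  exact ⟨⟨r, h₁⟩, by simpa using h₂⟩

theorem bIdx_spec {L : ℕ → ℤ} {x : ℕ} (hx : 1 < x) (hL : L 1 < L x) :
    1 ≤ bIdx L x ∧ bIdx L x < x ∧ L (bIdx L x) < L x ∧
      ∀ y, bIdx L x < y → y < x → L x ≤ L y := by
  have hbdd : BddAbove {y : ℕ | (1 ≤ y ∧ y < x ∧ L y < L x) ∨ y = 1} :=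
    ⟨x, by rintro y (h | h) <;> omega⟩
  have hmem : bIdx L x ∈ {y : ℕ | (1 ≤ y ∧ y < x ∧ L y < L x) ∨ y = 1} :=
    Nat.sSup_mem ⟨1, Or.inr rfl⟩ hbdd
  have hb : 1 ≤ bIdx L x ∧ bIdx L x < x ∧ L (bIdx L x) < L x := by
    rcases hmem with h | h
    · exact h
    · rw [h]; exact ⟨le_rfl, hx, hL⟩
  refine ⟨hb.1, hb.2.1, hb.2.2, fun y hy hyx => ?_⟩
  by_contra! h
  have hyb : y ≤ bIdx L x := le_csSup hbdd (Or.inl ⟨by omega, hyx, h⟩)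
  omega

theorem eIdx_spec {L : ℕ → ℤ} {n x : ℕ} (hx : x ≤ n) :
    x < eIdx L n x ∧ eIdx L n x ≤ n + 1 ∧ (eIdx L n x ≤ n → L (eIdx L n x) < L x) ∧
      ∀ y, x < y → y < eIdx L n x → L x ≤ L y := by
  have hmem : eIdx L n x ∈ {y : ℕ | (x < y ∧ y ≤ n ∧ L y < L x) ∨ y = n + 1} :=
    Nat.sInf_mem ⟨n + 1, Or.inr rfl⟩
  have he : x < eIdx L n x ∧ eIdx L n x ≤ n + 1 ∧ (eIdx L n x ≤ n → L (eIdx L n x) < L x) := by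
    rcases hmem with h | h
    · exact ⟨h.1, by omega, fun _ => h.2.2⟩
    · exact ⟨by omega, by omega, fun h' => by omega⟩
  refine ⟨he.1, he.2.1, he.2.2, fun y hy hye => ?_⟩
  by_contra! h
  have hey : eIdx L n x ≤ y := Nat.sInf_le (Or.inl ⟨hy, by omega, h⟩)
  omega

theorem Candt_spec_s7 {BWT w : ℕ → ℤ} {c : ℤ} {a a' p : ℕ} (hp : (p : ℤ) = Candt BWT w c a a') :
    a ≤ p ∧ p < a' ∧ BWT p = c ∧ 0 ≤ w p ∧
      ∀ q, a ≤ q → q < a' → BWT q = c → 0 ≤ w q → w q ≤ w p ∧ (w q = w p → p ≤ q) := by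
  unfold Candt at hp
  split_ifs at hp with hex
  set M := {m : ℕ | ∃ q : ℕ, a ≤ q ∧ q < a' ∧ BWT q = c ∧ 0 ≤ w q ∧ (m : ℤ) = w q} with hM
  have hbdd : BddAbove M := by
    refine (((Set.finite_Iio a').image fun q => (w q).toNat).subset ?_).bddAbove
    rintro m ⟨q, -, hq, -, -, hm⟩
    exact ⟨q, hq, by simp [← hm]⟩
  have hmem : sSup M ∈ M := by
    obtain ⟨q, h₁, h₂, h₃, h₄⟩ := hex
    exact Nat.sSup_mem ⟨(w q).toNat, q, h₁, h₂, h₃, h₄, by omega⟩ hbdd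
  have hw : wMax BWT w c a a' = (sSup M : ℕ) := rfl
  obtain ⟨r, hr₁, hr₂, hr₃, hr₄, hr⟩ := hmem
  have hpS : p ∈ {p : ℕ | a ≤ p ∧ p < a' ∧ BWT p = c ∧ w p = wMax BWT w c a a'} := by
    rw [Nat.cast_inj.mp hp]
    exact Nat.sInf_mem ⟨r, hr₁, hr₂, hr₃, by rw [hw, hr]⟩
  obtain ⟨h₁, h₂, h₃, h₄⟩ := hpS
  refine ⟨h₁, h₂, h₃, by omega, fun q hq₁ hq₂ hq₃ hq₄ => ⟨?_, fun hq => ?_⟩⟩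
  · have : (w q).toNat ≤ sSup M := le_csSup hbdd ⟨q, hq₁, hq₂, hq₃, hq₄, by omega⟩
    omega
  · rw [Nat.cast_inj.mp hp]
    exact Nat.sInf_le ⟨hq₁, hq₂, hq₃, hq.trans h₄⟩

theorem OccursIn.of_isSuffix_seg {T : ℕ → ℤ} {n k : ℕ} {s : List ℤ} (hk : k ≤ n)
    (h : s <:+ seg T 1 k) : OccursIn T n s := by
  have hlen : s.length ≤ k := by simpa [length_seg] using h.length_le
  refine ⟨k - s.length + 1, by omega, by omega, ?_⟩
  rw [List.suffix_iff_eq_drop.mp h]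
  apply List.ext_getElem
  · simp [length_seg]
  · intro i h₁ h₂
    simp only [List.length_drop, length_seg] at h₁
    simp only [seg, List.getElem_drop, List.getElem_map, List.getElem_range, List.length_drop,
      List.length_map, List.length_range]
    congr 1; omega

theorem isSuffix_seg_succ {T : ℕ → ℤ} {k : ℕ} {s : List ℤ} (h : s <:+ seg T 1 k) :
    s ++ [T (k + 1)] <:+ seg T 1 (k + 1) := by
  rw [seg_one_succ]
  obtain ⟨t, ht⟩ := h
  exact ⟨t, by rw [← List.append_assoc, ht]⟩

section Setup

variable {n σ : ℕ} {T : ℕ → ℤ} {dollar : ℤ} {SA : ℕ → ℕ} {BWT LCP w : ℕ → ℤ}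

/-- The interval `[b(x), e(x))` consists of the indices of the suffixes of the reversed text
that start with a string of length `LCP x` which is a prefix of the `x`-th one. -/
theorem LCPSetup.isPrefix_iff (hs : LCPSetup n σ T dollar SA LCP) {x : ℕ} (hx : 1 < x)
    (hxn : x ≤ n) {A : List ℤ} (hA : (A.length : ℤ) = LCP x)
    (hAx : A <+: sfx (Trev T n) n (SA x)) {i : ℕ} (hi : 1 ≤ i) (hin : i ≤ n) :
    A <+: sfx (Trev T n) n (SA i) ↔ bIdx LCP x ≤ i ∧ i < eIdx LCP n x := by
  obtain ⟨hb₁, hbx, hbL, hb⟩ := bIdx_spec hx (L := LCP) (by rw [hs.hLCP1]; omega)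
  obtain ⟨hex, hen, heL, he⟩ := eIdx_spec hxn (L := LCP)
  set b := bIdx LCP x
  set e := eIdx LCP n x
  have hconv : ∀ j k l, 1 ≤ j → j ≤ k → k ≤ l → l ≤ n → A <+: sfx (Trev T n) n (SA j) →
      A <+: sfx (Trev T n) n (SA l) → A <+: sfx (Trev T n) n (SA k) := by
    intro j k l hj hjk hkl hl h₁ h₂
    rcases hjk.eq_or_lt with rfl | hjk
    · exact h₁
    rcases hkl.eq_or_lt with rfl | hkl
    · exact h₂
    exact isPrefix_of_lex_lex h₁ h₂ (hs.hSAord j k hj hjk (by omega))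
      (hs.hSAord k l (by omega) hkl hl)
  have hstep : ∀ j, 1 < j → j ≤ n → A <+: sfx (Trev T n) n (SA (j - 1)) →
      A <+: sfx (Trev T n) n (SA j) → LCP x ≤ LCP j := by
    intro j hj hjn h₁ h₂
    rw [hs.hLCP j hj hjn, ← hA]
    exact_mod_cast length_le_lcpLen h₁ h₂
  have hiff : ∀ j, b < j → j < e → (A <+: sfx (Trev T n) n (SA (j - 1)) ↔
      A <+: sfx (Trev T n) n (SA j)) := by
    intro j hbj hje
    apply isPrefix_iff_of_length_le_lcpLen
    have : LCP x ≤ LCP j := by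
      rcases lt_trichotomy j x with h | h | h
      · exact hb j hbj h
      · rw [h]
      · exact he j h hje
    rw [hs.hLCP j (by omega) (by omega), ← hA] at this
    exact_mod_cast this
  constructor
  · intro h
    constructor
    · by_contra! hlt
      have := hstep b (by omega) (by omega)
        (hconv i (b - 1) x hi (by omega) (by omega) hxn h hAx)
        (hconv i b x hi (by omega) (by omega) hxn h hAx)
      omega
    · by_contra! hge
      have := hstep e (by omega) (by omega)
        (hconv x (e - 1) i (by omega) (by omega) (by omega) hin hAx h)
        (hconv x e i (by omega) (by omega) (by omega) hin hAx h)
      have := heL (by omega)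
      omega
  · rintro ⟨hbi, hie⟩
    have hall : ∀ k, b + k < e → (A <+: sfx (Trev T n) n (SA b) ↔
        A <+: sfx (Trev T n) n (SA (b + k))) := by
      intro k
      induction k with
      | zero => simp
      | succ k ih =>
        intro hk
        rw [ih (by omega)]
        exact hiff (b + k + 1) (by omega) hk
    have h₁ := hall (x - b) (by omega)
    have h₂ := hall (i - b) (by omega)
    rw [Nat.add_sub_cancel' hbx.le] at h₁
    rw [Nat.add_sub_cancel' hbi] at h₂
    exact h₂.mp (h₁.mpr hAx)

/-- A prefix of a suffix of the reversed text which avoids the sentinel is the reversal of a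
suffix of the corresponding prefix of the text. -/
theorem SASetup.isPrefix_sfx_iff (hs : SASetup n σ T dollar SA) {i : ℕ} (hi : 1 ≤ i)
    (hin : i ≤ n) {A : List ℤ} (hA : dollar ∉ A) :
    A <+: sfx (Trev T n) n (SA i) ↔ A.reverse <:+ seg T 1 (n - SA i) := by
  obtain ⟨h₁, h₂⟩ := hs.hSAmem i hi hin
  rw [sfx_Trev T h₂, hs.hTn, List.prefix_concat_iff, ← List.reverse_prefix,
    List.reverse_reverse, or_iff_right]
  rintro rfl
  simp at hA

theorem SASetup.dollar_notMem (hs : SASetup n σ T dollar SA) {i j : ℕ} (hi : 1 ≤ i)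
    (hin : i ≤ n) (hj : 1 ≤ j) (hjn : j ≤ n) (hij : i ≠ j) {A : List ℤ}
    (hAi : A <+: sfx (Trev T n) n (SA i)) (hAj : A <+: sfx (Trev T n) n (SA j)) :
    dollar ∉ A := by
  intro hmem
  have key : ∀ k, 1 ≤ k → k ≤ n → A <+: sfx (Trev T n) n (SA k) →
      A.length = n - SA k + 1 := by
    intro k hk hkn h
    obtain ⟨h₁, h₂⟩ := hs.hSAmem k hk hkn
    rw [sfx_Trev T h₂, List.prefix_concat_iff] at h
    rcases h with rfl | h
    · simp [length_seg]
    · obtain ⟨l, hl₁, hl₂, hl⟩ := mem_seg_one (List.mem_reverse.mp (h.subset hmem))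
      exact absurd hl (hs.hTne l hl₁ (by omega))
  have h₁ := key i hi hin hAi
  have h₂ := key j hj hjn hAj
  have h₃ := hs.hSAmem i hi hin
  have h₄ := hs.hSAmem j hj hjn
  exact hij (hs.hSAinj i j hi hin hj hjn (by omega))

theorem FullSetup.append_BWT_isSuffix (hs : FullSetup n σ T dollar SA BWT LCP w) {i : ℕ}
    (hi : 1 ≤ i) (hin : i ≤ n) {s : List ℤ} (h : s <:+ seg T 1 (n - SA i)) :
    s ++ [BWT i] <:+ seg T 1 (n - SA i + 1) := by
  rw [hs.hBWT i hi hin]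
  exact isSuffix_seg_succ h

theorem FullSetup.occursIn_append_BWT (hs : FullSetup n σ T dollar SA BWT LCP w) {i : ℕ}
    (hi : 1 ≤ i) (hin : i ≤ n) {s : List ℤ} (h : s <:+ seg T 1 (n - SA i)) :
    OccursIn T n (s ++ [BWT i]) := by
  have := hs.hSAmem i hi hin
  exact .of_isSuffix_seg (by omega) (hs.append_BWT_isSuffix hi hin h)

theorem FullSetup.BWT_mem (hs : FullSetup n σ T dollar SA BWT LCP w) {i : ℕ}
    (hi : 1 ≤ i) (hin : i ≤ n) : 1 ≤ BWT i ∧ BWT i ≤ σ := by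
  have := hs.hSAmem i hi hin
  rw [hs.hBWT i hi hin]
  exact hs.hT _ (by omega) (by omega)

/-- Every element of `FullL` ends an occurrence of a one-character extension `β c` of a
right-maximal string `β`, and its index `p` is optimal among the indices of all occurrences of
`α c`, for some suffix `α` of `β`. -/
theorem FullSetup.exists_of_mem_FullL (hs : FullSetup n σ T dollar SA BWT LCP w) {q : ℕ}
    (hq : q ∈ FullL n SA BWT LCP w) :
    ∃ (p : ℕ) (α β : List ℤ), 1 ≤ p ∧ p ≤ n ∧ q = n - SA p + 1 ∧ RightMax T n σ β ∧
      β <:+ seg T 1 (n - SA p) ∧ α <:+ β ∧ w p = β.length ∧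
      ∀ p', 1 ≤ p' → p' ≤ n → BWT p' = BWT p → α <:+ seg T 1 (n - SA p') → 0 ≤ w p' →
        w p' ≤ w p ∧ (w p' = w p → p ≤ p') := by
  obtain ⟨x, hx, hxn, hne, c, -, p, hp, rfl⟩ := hq
  obtain ⟨A, hAlen, hA₁, hA₂⟩ := exists_isPrefix_length_eq_lcpLen
    (sfx (Trev T n) n (SA (x - 1))) (sfx (Trev T n) n (SA x))
  have hA : (A.length : ℤ) = LCP x := by rw [hs.hLCP x hx hxn, hAlen]
  have hAd : dollar ∉ A := hs.dollar_notMem (i := x - 1) (j := x) (by omega) (by omega)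
    (by omega) hxn (by omega) hA₁ hA₂
  have hint : ∀ i, 1 ≤ i → i ≤ n → (A.reverse <:+ seg T 1 (n - SA i) ↔
      bIdx LCP x ≤ i ∧ i < eIdx LCP n x) := fun i hi hin => by
    rw [← hs.isPrefix_sfx_iff hi hin hAd, hs.isPrefix_iff hx hxn hA hA₂ hi hin]
  have hα : RightMax T n σ A.reverse := by
    have h₁ := hs.BWT_mem (i := x) (by omega) hxn
    have h₂ := hs.BWT_mem (i := x - 1) (by omega) (by omega)
    exact ⟨BWT x, BWT (x - 1), hne, h₁.1, h₁.2, h₂.1, h₂.2,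
      hs.occursIn_append_BWT (by omega) hxn ((hs.isPrefix_sfx_iff (by omega) hxn hAd).mp hA₂),
      hs.occursIn_append_BWT (by omega) (by omega)
        ((hs.isPrefix_sfx_iff (by omega) (by omega) hAd).mp hA₁)⟩
  obtain ⟨hbp, hpe, rfl, hw, hopt⟩ := Candt_spec_s7 hp
  have hb₁ := (bIdx_spec hx (L := LCP) (by rw [hs.hLCP1]; omega)).1
  have hen := (eIdx_spec hxn (L := LCP)).2.1
  have hp₁ : 1 ≤ p := by omega
  have hpn : p ≤ n := by omega
  have hαp := (hint p hp₁ hpn).mpr ⟨hbp, hpe⟩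
  have hrb : RunBoundary BWT n p := by
    by_contra h
    have := hs.hwNot p hp₁ hpn h
    omega
  obtain ⟨⟨β, hβ, hβp, hwβ⟩, hmax⟩ := hs.hwRB p hp₁ hpn hrb ⟨_, hα, hαp⟩
  have hαβ : A.reverse.length ≤ β.length := by
    have := hmax ⟨_, hα, hαp, rfl⟩
    rw [hwβ] at this
    exact_mod_cast this
  refine ⟨p, A.reverse, β, hp₁, hpn, rfl, hβ, hβp,
    List.suffix_of_suffix_length_le hαp hβp hαβ, hwβ, fun p' h₁ h₂ h₃ h₄ h₅ => ?_⟩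
  obtain ⟨h₆, h₇⟩ := (hint p' h₁ h₂).mp h₄
  exact hopt p' h₆ h₇ h₃ h₅

end Setup

/-- For every set `F ⊆ {1,…,n}` that is suffixient for `T`, the cardinality of
`F` is at least the cardinality of `FullL`. -/
theorem stmt7 (n σ : ℕ) (T : ℕ → ℤ) (dollar : ℤ) (SA : ℕ → ℕ) (BWT LCP w : ℕ → ℤ)
    (hsetup : FullSetup n σ T dollar SA BWT LCP w)
    (F : Set ℕ) (hF : F ⊆ Set.Icc 1 n) (hsuff : Suffixient T n σ F) :
    (FullL n SA BWT LCP w).ncard ≤ F.ncard := by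
  have hFfin : F.Finite := (Set.finite_Icc 1 n).subset hF
  have hex : ∀ q ∈ FullL n SA BWT LCP w, ∃ f ∈ F, ∃ (p : ℕ) (α β : List ℤ),
      1 ≤ p ∧ p ≤ n ∧ q = n - SA p + 1 ∧ β <:+ seg T 1 (n - SA p) ∧ α <:+ β ∧
      w p = β.length ∧
      (∀ p', 1 ≤ p' → p' ≤ n → BWT p' = BWT p → α <:+ seg T 1 (n - SA p') → 0 ≤ w p' →
        w p' ≤ w p ∧ (w p' = w p → p ≤ p')) ∧ β ++ [BWT p] <:+ seg T 1 f := by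
    intro q hq
    obtain ⟨p, α, β, hp₁, hpn, hqp, hβ, hβp, hαβ, hw, hopt⟩ := hsetup.exists_of_mem_FullL hq
    obtain ⟨f, hf, hfβ⟩ := hsuff β hβ (BWT p) (hsetup.BWT_mem hp₁ hpn).1
      (hsetup.BWT_mem hp₁ hpn).2 (hsetup.occursIn_append_BWT hp₁ hpn hβp)
    exact ⟨f, hf, p, α, β, hp₁, hpn, hqp, hβp, hαβ, hw, hopt, hfβ⟩
  choose! f hfF hf using hex
  refine Set.ncard_le_ncard_of_injOn f hfF ?_ hFfin
  intro q₁ hq₁ q₂ hq₂ heq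
  obtain ⟨p₁, α₁, β₁, hp₁, hpn₁, rfl, hβp₁, hαβ₁, hw₁, hopt₁, hf₁⟩ := hf q₁ hq₁
  obtain ⟨p₂, α₂, β₂, hp₂, hpn₂, rfl, hβp₂, hαβ₂, hw₂, hopt₂, hf₂⟩ := hf q₂ hq₂
  rw [heq] at hf₁
  have hcomp : (β₁ <:+ β₂ ∨ β₂ <:+ β₁) ∧ BWT p₁ = BWT p₂ := by
    rcases List.suffix_or_suffix_of_suffix hf₁ hf₂ with h | h
    · exact (isSuffix_and_eq_of_concat_isSuffix h).imp_left Or.inl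
    · exact (isSuffix_and_eq_of_concat_isSuffix h).imp Or.inr Eq.symm
  obtain ⟨hβ, hc⟩ := hcomp
  have hβeq : β₁ = β₂ := by
    rcases hβ with h | h
    · have := (hopt₁ p₂ hp₂ hpn₂ hc.symm ((hαβ₁.trans h).trans hβp₂) (by omega)).1
      exact h.eq_of_length_le (by omega)
    · have := (hopt₂ p₁ hp₁ hpn₁ hc ((hαβ₂.trans h).trans hβp₁) (by omega)).1
      exact (h.eq_of_length_le (by omega)).symm
  subst hβeq
  have h₁ := (hopt₁ p₂ hp₂ hpn₂ hc.symm (hαβ₁.trans hβp₂) (by omega)).2 (by omega)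
  have h₂ := (hopt₂ p₁ hp₁ hpn₁ hc (hαβ₂.trans hβp₁) (by omega)).2 (by omega)
  rw [le_antisymm h₁ h₂]
end
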